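/- arXiv:1706.08557 — 6 statements merged into one kernel-verified Lean document; each statement's English description precedes it below -/
import Mathlib

section
/- Let g > 0, λ ≥ 0, r ∈ ℕ, and set h = g/2. Then Σ_{m=0}^{∞} (e^{−λ/2}(λ/2)^m/m!) · 2^r (h+m)_r = 2^r Σ_{i=0}^{r} Σ_{j=0}^{i} S(i,j) · (1/i!) · [d^i/dh^i (h)_r] · (λ/2)^j. (The left-hand side is the r-th moment about zero of the non-central chi-squared distribution with g degrees of freedom and non-centrality parameter λ, computed from its Poisson mixture representation, since the r-th moment of a chi-squared distribution with ν degrees of freedom is 2^r (ν/2)_r.) -/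
open scoped Nat

/-- Ascending factorial (Pochhammer symbol) `(a)_n = a(a+1)⋯(a+n-1)` for a real `a`. -/
noncomputable def asc (a : ℝ) (n : ℕ) : ℝ := Polynomial.eval a (ascPochhammer ℝ n)

/-- Stirling numbers of the second kind. -/
def stirling2 : ℕ → ℕ → ℕ
  | 0, 0 => 1
  | 0, _ + 1 => 0
  | _ + 1, 0 => 0
  | i + 1, j + 1 => (j + 1) * stirling2 i (j + 1) + stirling2 i j

theorem hasSum_pow_div_factorial_mul_descFactorial (t : ℝ) (j : ℕ) :
    HasSum (fun m : ℕ => t ^ m / (m ! : ℝ) * (m.descFactorial j : ℝ)) (t ^ j * Real.exp t) := by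
  have hexp : HasSum (fun m : ℕ => t ^ m / (m ! : ℝ)) (Real.exp t) := by
    rw [Real.exp_eq_exp_ℝ]
    exact NormedSpace.expSeries_div_hasSum_exp t
  rw [← (add_left_injective j).hasSum_iff]
  · refine (hexp.mul_left (t ^ j)).congr_fun ?_
    intro m
    have hfac : ((m ! : ℕ) : ℝ) * ((m + j).descFactorial j : ℝ) = ((m + j)! : ℝ) := by
      have := Nat.factorial_mul_descFactorial (Nat.le_add_left j m)
      rw [Nat.add_sub_cancel] at this
      exact_mod_cast this
    have h1 : ((m ! : ℕ) : ℝ) ≠ 0 := by positivity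
    have h2 : (((m + j)! : ℕ) : ℝ) ≠ 0 := by positivity
    simp only [Function.comp_apply]
    field_simp
    rw [← hfac]
    ring
  · intro m hm
    have hlt : m < j := by
      by_contra hle
      exact hm ⟨m - j, Nat.sub_add_cancel (not_lt.mp hle)⟩
    simp [Nat.descFactorial_eq_zero_iff_lt.mpr hlt]

theorem stirling2_eq_stirlingSecond (i j : ℕ) : stirling2 i j = Nat.stirlingSecond i j := by
  induction i generalizing j with
  | zero => cases j <;> rfl
  | succ i ih =>
    cases j with
    | zero => rfl
    | succ j => rw [stirling2, Nat.stirlingSecond, ih, ih]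

theorem pow_eq_sum_stirling2_mul_descFactorial (m i : ℕ) :
    (m : ℝ) ^ i = ∑ j ∈ Finset.range (i + 1), (stirling2 i j : ℝ) * (m.descFactorial j : ℝ) := by
  induction i with
  | zero => simp [stirling2]
  | succ i ih =>
    have hmul (j : ℕ) : (m : ℝ) * (m.descFactorial j : ℝ) =
        (m.descFactorial (j + 1) : ℝ) + j * (m.descFactorial j : ℝ) := by
      rw [Nat.descFactorial_succ]
      rcases le_or_gt j m with hj | hj
      · push_cast [hj]
        ring
      · simp [Nat.descFactorial_eq_zero_iff_lt.mpr hj]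
    have htop : stirling2 i (i + 1) = 0 := by
      rw [stirling2_eq_stirlingSecond, Nat.stirlingSecond_eq_zero_of_lt i.lt_succ_self]
    have hshift : ∑ j ∈ Finset.range (i + 1),
          ((j + 1 : ℕ) : ℝ) * (stirling2 i (j + 1) : ℝ) * (m.descFactorial (j + 1) : ℝ) =
        ∑ j ∈ Finset.range (i + 1),
          (j : ℝ) * (stirling2 i j : ℝ) * (m.descFactorial j : ℝ) := by
      have h1 := Finset.sum_range_succ' (fun j : ℕ =>
        (j : ℝ) * (stirling2 i j : ℝ) * (m.descFactorial j : ℝ)) (i + 1)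
      rw [Finset.sum_range_succ] at h1
      simpa [htop] using h1.symm
    have hrec (j : ℕ) : (stirling2 (i + 1) (j + 1) : ℝ) * (m.descFactorial (j + 1) : ℝ) =
        ((j + 1 : ℕ) : ℝ) * (stirling2 i (j + 1) : ℝ) * (m.descFactorial (j + 1) : ℝ) +
          (stirling2 i j : ℝ) * (m.descFactorial (j + 1) : ℝ) := by
      rw [stirling2]
      push_cast
      ring
    have hzero : stirling2 (i + 1) 0 = 0 := by rw [stirling2]
    rw [Finset.sum_range_succ', hzero, Nat.cast_zero, zero_mul, add_zero,
      Finset.sum_congr rfl fun j _ => hrec j, Finset.sum_add_distrib, hshift,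
      ← Finset.sum_add_distrib, pow_succ, ih, Finset.sum_mul]
    refine Finset.sum_congr rfl fun j _ => ?_
    linear_combination (stirling2 i j : ℝ) * hmul j

theorem iteratedDeriv_polynomial_eval (p : Polynomial ℝ) (i : ℕ) :
    iteratedDeriv i (fun x => p.eval x) =
      fun x => (Polynomial.derivative^[i] p).eval x := by
  induction i generalizing p with
  | zero => simp
  | succ i ih =>
    have hd : deriv (fun x => p.eval x) = fun x => p.derivative.eval x := by
      ext x
      exact p.deriv
    rw [iteratedDeriv_succ', hd, ih, Function.iterate_succ_apply]

theorem asc_add_eq_sum_iteratedDeriv (h x : ℝ) (r : ℕ) :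
    asc (h + x) r = ∑ i ∈ Finset.range (r + 1),
      1 / (i ! : ℝ) * iteratedDeriv i (fun y : ℝ => asc y r) h * x ^ i := by
  have heval : asc (h + x) r = (Polynomial.taylor h (ascPochhammer ℝ r)).eval x := by
    rw [Polynomial.taylor_eval, add_comm, asc]
  rw [heval, Polynomial.eval_eq_sum_range, Polynomial.natDegree_taylor, ascPochhammer_natDegree]
  refine Finset.sum_congr rfl fun i _ => ?_
  have hder : iteratedDeriv i (fun y : ℝ => asc y r) h =
      (i ! : ℝ) * (Polynomial.hasseDeriv i (ascPochhammer ℝ r)).eval h := by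
    simp only [asc, iteratedDeriv_polynomial_eval]
    rw [← Polynomial.factorial_smul_hasseDeriv]
    simp
  have hi : ((i ! : ℕ) : ℝ) ≠ 0 := by positivity
  rw [hder, Polynomial.taylor_coeff]
  field_simp

/-- Moments about zero of the non-central chi-squared distribution `χ'²_g(λ)`:
the Poisson mixture of the chi-squared moments `2^r (h+m)_r` (with `h = g/2`) equals
`2^r Σ_{i=0}^{r} Σ_{j=0}^{i} S(i,j) (1/i!) [d^i/dh^i (h)_r] (λ/2)^j`. -/
theorem noncentral_chiSq_moment (g lam : ℝ) (hg : 0 < g) (hlam : 0 ≤ lam) (r : ℕ)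
    (h : ℝ) (hh : h = g / 2) :
    (∑' m : ℕ, (Real.exp (-(lam / 2)) * (lam / 2) ^ m / (m ! : ℝ)) *
        (2 ^ r * asc (h + m) r)) =
      2 ^ r * ∑ i ∈ Finset.range (r + 1), ∑ j ∈ Finset.range (i + 1),
        (stirling2 i j : ℝ) * (1 / (i ! : ℝ)) *
          iteratedDeriv i (fun x : ℝ => asc x r) h * (lam / 2) ^ j := by
  set t := lam / 2
  have hterm (i j : ℕ) := (hasSum_pow_div_factorial_mul_descFactorial t j).mul_left
    (Real.exp (-t) * 2 ^ r * ((stirling2 i j : ℝ) * (1 / (i ! : ℝ)) *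
      iteratedDeriv i (fun x : ℝ => asc x r) h))
  have hsum := hasSum_sum fun i (_ : i ∈ Finset.range (r + 1)) =>
    hasSum_sum fun j (_ : j ∈ Finset.range (i + 1)) => hterm i j
  have hexp : Real.exp (-t) * Real.exp t = 1 := by rw [← Real.exp_add]; simp
  refine Eq.trans (tsum_congr fun m => ?_) (hsum.tsum_eq.trans ?_)
  · rw [asc_add_eq_sum_iteratedDeriv]
    simp only [pow_eq_sum_stirling2_mul_descFactorial, Finset.mul_sum]
    refine Finset.sum_congr rfl fun i _ => Finset.sum_congr rfl fun j _ => ?_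
    ring
  · simp only [Finset.mul_sum]
    refine Finset.sum_congr rfl fun i _ => Finset.sum_congr rfl fun j _ => ?_
    linear_combination (2 ^ r * ((stirling2 i j : ℝ) * (1 / (i ! : ℝ)) *
      iteratedDeriv i (fun x : ℝ => asc x r) h) * t ^ j) * hexp
end

section
/- Let r ∈ ℕ and h ∈ ℝ with h ≠ 0. Then for every j = 0, …, r: binomial(r,j) · (h+j)_{r−j} = Σ_{i=j}^{r} S(i,j) · (1/i!) · [d^i/dh^i (h)_r], where (h+j)_{r−j} = (h)_r/(h)_j whenever (h)_j ≠ 0. -/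
open scoped Nat

theorem stirling2_eq_zero_of_lt : ∀ {i j : ℕ}, i < j → stirling2 i j = 0
  | 0, _ + 1, _ => by rw [stirling2]
  | i + 1, j + 1, hij => by
    rw [stirling2, stirling2_eq_zero_of_lt (by omega : i < j + 1),
      stirling2_eq_zero_of_lt (by omega : i < j), mul_zero]

theorem asc_succ (a : ℝ) (n : ℕ) : asc a (n + 1) = asc a n * (a + n) :=
  ascPochhammer_succ_eval n a

theorem asc_succ_left (a : ℝ) (n : ℕ) : asc a (n + 1) = a * asc (a + 1) n := by
  simp [asc, ascPochhammer_succ_left]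

theorem choose_succ_mul_asc (r k : ℕ) (h : ℝ) :
    ((r + 1).choose (k + 1) : ℝ) * asc (h + (k + 1 : ℕ)) (r - k) =
      (h + r + (k + 1)) * (r.choose (k + 1) * asc (h + (k + 1 : ℕ)) (r - (k + 1))) +
        r.choose k * asc (h + k) (r - k) := by
  rcases lt_trichotomy k r with hk | rfl | hk
  · obtain ⟨d, rfl⟩ := Nat.exists_eq_add_of_lt hk
    have hc := Nat.choose_succ_right_eq (k + d + 1) k
    rw [show k + d + 1 - k = d + 1 by omega] at hc ⊢
    rw [show k + d + 1 - (k + 1) = d by omega, asc_succ_left (h + k), asc_succ, Nat.choose_succ_succ']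
    have hc' : ((k + d + 1).choose (k + 1) : ℝ) * (k + 1) = (k + d + 1).choose k * (d + 1) := by
      exact_mod_cast hc
    push_cast
    rw [← add_assoc]
    linear_combination (-asc (h + k + 1) d) * hc'
  · simp [asc]
  · simp [Nat.choose_eq_zero_of_lt hk, Nat.choose_eq_zero_of_lt (hk.trans (Nat.lt_succ_self k))]
    left
    exact Nat.choose_eq_zero_of_lt (by omega)

open Polynomial in
theorem taylor_ascPochhammer_succ (h : ℝ) (r : ℕ) :
    taylor h (ascPochhammer ℝ (r + 1)) =
      taylor h (ascPochhammer ℝ r) * X + C (h + r) * taylor h (ascPochhammer ℝ r) := by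
  rw [ascPochhammer_succ_right, taylor_mul, ← C_eq_natCast, map_add, taylor_X, taylor_C, C_add]
  ring

open Polynomial in
theorem sum_stirling2_mul_taylor_coeff (h : ℝ) (r j : ℕ) :
    ∑ i ∈ Finset.range (r + 1), (stirling2 i j : ℝ) * (taylor h (ascPochhammer ℝ r)).coeff i =
      r.choose j * asc (h + j) (r - j) := by
  induction r generalizing j with
  | zero => cases j <;> simp [stirling2, asc]
  | succ r ih =>
    have hdeg : (taylor h (ascPochhammer ℝ r)).coeff (r + 1) = 0 := by
      apply coeff_eq_zero_of_natDegree_lt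
      simp [natDegree_taylor, ascPochhammer_natDegree]
    have key : ∑ i ∈ Finset.range (r + 1 + 1),
        (stirling2 i j : ℝ) * (taylor h (ascPochhammer ℝ (r + 1))).coeff i =
        (h + r) * (r.choose j * asc (h + j) (r - j)) +
        ∑ i ∈ Finset.range (r + 1),
          (stirling2 (i + 1) j : ℝ) * (taylor h (ascPochhammer ℝ r)).coeff i := by
      simp_rw [taylor_ascPochhammer_succ, coeff_add, coeff_C_mul, mul_add, Finset.sum_add_distrib]
      rw [Finset.sum_range_succ', add_comm, Finset.sum_range_succ, hdeg, ← ih, Finset.mul_sum]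
      simp only [coeff_mul_X, mul_coeff_zero, coeff_X_zero, mul_zero, add_zero]
      congr 1
      exact Finset.sum_congr rfl fun i _ => by ring
    rw [key]
    cases j with
    | zero =>
      simp [stirling2, asc_succ]
      ring
    | succ k =>
      simp only [stirling2, Nat.cast_add, Nat.cast_mul, add_mul _ _ (coeff _ _),
        Finset.sum_add_distrib, mul_assoc]
      rw [← Finset.mul_sum, ih, ih, Nat.add_sub_add_right]
      have := choose_succ_mul_asc r k h
      push_cast at this ⊢
      rw [this]
      ring

open Polynomial in
theorem iteratedDeriv_eval (p : ℝ[X]) (i : ℕ) :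
    iteratedDeriv i (fun x => p.eval x) = fun x => (derivative^[i] p).eval x := by
  induction i with
  | zero => simp
  | succ i ih =>
    rw [iteratedDeriv_succ, ih, Function.iterate_succ_apply']
    ext x
    exact Polynomial.deriv _

open Polynomial in
theorem iteratedDeriv_eval_eq_factorial_mul_taylor_coeff (p : ℝ[X]) (i : ℕ) (h : ℝ) :
    iteratedDeriv i (fun x => p.eval x) h = i ! * (taylor h p).coeff i := by
  rw [iteratedDeriv_eval, taylor_coeff, ← factorial_smul_hasseDeriv]
  simp

/-- Identity: for `0 ≤ j ≤ r` and `h ≠ 0`,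
`C(r,j) · (h+j)_{r−j} = Σ_{i=j}^{r} S(i,j) (1/i!) [d^i/dh^i (h)_r]`
(where `(h+j)_{r−j} = (h)_r/(h)_j` whenever `(h)_j ≠ 0`). -/
theorem stirling_pochhammer_identity (r : ℕ) (h : ℝ) (hh : h ≠ 0) (j : ℕ) (hj : j ≤ r) :
    (r.choose j : ℝ) * asc (h + j) (r - j) =
      ∑ i ∈ Finset.Icc j r,
        (stirling2 i j : ℝ) * (1 / (i ! : ℝ)) * iteratedDeriv i (fun x : ℝ => asc x r) h := by
  rw [← sum_stirling2_mul_taylor_coeff]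
  symm
  apply Finset.sum_subset_zero_on_sdiff
  · intro i hi
    simp only [Finset.mem_Icc, Finset.mem_range] at *
    omega
  · intro i hi
    simp only [Finset.mem_sdiff, Finset.mem_Icc, Finset.mem_range] at hi
    rw [stirling2_eq_zero_of_lt (by omega), Nat.cast_zero, zero_mul]
  · intro i _
    simp only [asc]
    rw [iteratedDeriv_eval_eq_factorial_mul_taylor_coeff]
    field_simp
end

section
/- Let α1, α2 > 0, λ1, λ2 ≥ 0, and set α⁺ = α1 + α2, λ⁺ = λ1 + λ2. Then for every x with 0 < x < 1: Σ_{j=0}^{∞} Σ_{k=0}^{∞} (e^{−λ1/2}(λ1/2)^j/j!)·(e^{−λ2/2}(λ2/2)^k/k!) · x^{α1+j−1}(1−x)^{α2+k−1}/B(α1+j, α2+k) = [x^{α1−1}(1−x)^{α2−1}/B(α1, α2)] · e^{−λ⁺/2} · Σ_{j=0}^{∞} Σ_{k=0}^{∞} [(α⁺)_{j+k}/((α1)_j (α2)_k)] · ((λ1/2)·x)^j/j! · ((λ2/2)·(1−x))^k/k!. -/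
open scoped Nat

/-- Euler beta function `B(a,b) = Γ(a)Γ(b)/Γ(a+b)`. -/
noncomputable def betaFn (a b : ℝ) : ℝ := Real.Gamma a * Real.Gamma b / Real.Gamma (a + b)

theorem asc_pos {a : ℝ} (ha : 0 < a) (n : ℕ) : 0 < asc a n :=
  ascPochhammer_pos n a ha

theorem Gamma_add_natCast_eq_asc_mul {a : ℝ} (ha : 0 < a) (n : ℕ) :
    Real.Gamma (a + n) = asc a n * Real.Gamma a := by
  induction n with
  | zero => simp [asc]
  | succ n ih =>
    have hn : a + n ≠ 0 := by positivity
    have hstep : asc a (n + 1) = asc a n * (a + n) := by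
      simp [asc, ascPochhammer_succ_eval]
    rw [hstep, Nat.cast_succ, ← add_assoc, Real.Gamma_add_one hn, ih]
    ring

theorem betaFn_add_natCast {a b : ℝ} (ha : 0 < a) (hb : 0 < b) (j k : ℕ) :
    betaFn (a + j) (b + k) = betaFn a b * (asc a j * asc b k / asc (a + b) (j + k)) := by
  have hab : a + j + (b + k) = a + b + ((j + k : ℕ) : ℝ) := by
    push_cast
    ring
  rw [betaFn, betaFn, hab, Gamma_add_natCast_eq_asc_mul ha, Gamma_add_natCast_eq_asc_mul hb,
    Gamma_add_natCast_eq_asc_mul (add_pos ha hb), div_mul_div_comm]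
  ring

theorem rpow_add_natCast_sub_one {x : ℝ} (hx : 0 < x) (a : ℝ) (n : ℕ) :
    x ^ (a + (n : ℝ) - 1) = x ^ (a - 1) * x ^ n := by
  rw [add_sub_right_comm, Real.rpow_add hx, Real.rpow_natCast]

/-- Perturbation representation of the doubly non-central beta density: for `0 < x < 1`,
the density equals the beta density times `e^{−λ⁺/2} Ψ₂[α⁺; α1, α2; (λ1/2)x, (λ2/2)(1−x)]`. -/
theorem dncBeta_density_perturbation (α1 α2 lam1 lam2 : ℝ)
    (hα1 : 0 < α1) (hα2 : 0 < α2) (hl1 : 0 ≤ lam1) (hl2 : 0 ≤ lam2)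
    (x : ℝ) (hx0 : 0 < x) (hx1 : x < 1) :
    (∑' j : ℕ, ∑' k : ℕ,
        (Real.exp (-(lam1 / 2)) * (lam1 / 2) ^ j / (j ! : ℝ)) *
          (Real.exp (-(lam2 / 2)) * (lam2 / 2) ^ k / (k ! : ℝ)) *
          (x ^ (α1 + (j : ℝ) - 1) * (1 - x) ^ (α2 + (k : ℝ) - 1) /
            betaFn (α1 + j) (α2 + k))) =
      (x ^ (α1 - 1) * (1 - x) ^ (α2 - 1) / betaFn α1 α2) *
        Real.exp (-((lam1 + lam2) / 2)) *
        ∑' j : ℕ, ∑' k : ℕ,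
          (asc (α1 + α2) (j + k) / (asc α1 j * asc α2 k)) *
            ((lam1 / 2 * x) ^ j / (j ! : ℝ)) * ((lam2 / 2 * (1 - x)) ^ k / (k ! : ℝ)) := by
  simp_rw [← tsum_mul_left]
  refine tsum_congr fun j => tsum_congr fun k => ?_
  have h1 := (asc_pos hα1 j).ne'
  have h2 := (asc_pos hα2 k).ne'
  have h12 := (asc_pos (add_pos hα1 hα2) (j + k)).ne'
  have hB : betaFn α1 α2 ≠ 0 := (ProbabilityTheory.beta_pos hα1 hα2).ne'
  have hexp : Real.exp (-((lam1 + lam2) / 2)) =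
      Real.exp (-(lam1 / 2)) * Real.exp (-(lam2 / 2)) := by
    rw [← Real.exp_add]
    ring_nf
  rw [rpow_add_natCast_sub_one hx0, rpow_add_natCast_sub_one (sub_pos.2 hx1),
    betaFn_add_natCast hα1 hα2, hexp, mul_pow, mul_pow]
  generalize x ^ (α1 - 1) = u, (1 - x) ^ (α2 - 1) = v, (1 - x) ^ k = w
  field_simp
end

section
/- Let λ1, λ2 ≥ 0 and, for 0 < x < 1, define f(x) = Σ_{j=0}^{∞} Σ_{k=0}^{∞} (e^{−λ1/2}(λ1/2)^j/j!)·(e^{−λ2/2}(λ2/2)^k/k!) · x^j (1−x)^k/B(1+j, 1+k) (the doubly non-central beta density with both shape parameters equal to 1). Then f(x) tends to e^{−λ1/2}·(λ2/2 + 1) as x → 0⁺, and f(x) tends to e^{−λ2/2}·(λ1/2 + 1) as x → 1⁻. -/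
open scoped Nat

/-- The term of the double series for the doubly non-central beta density with unit shapes. -/
noncomputable def dncBetaTerm (a b : ℝ) (p : ℕ × ℕ) (x : ℝ) : ℝ :=
  (Real.exp (-a) * a ^ p.1 / (p.1 ! : ℝ)) * (Real.exp (-b) * b ^ p.2 / (p.2 ! : ℝ)) *
    (x ^ p.1 * (1 - x) ^ p.2 / betaFn (1 + p.1) (1 + p.2))

lemma inv_betaFn_one_add (j k : ℕ) :
    (betaFn (1 + j) (1 + k))⁻¹ = ((j : ℝ) + k + 1) * ((j + k).choose j : ℝ) := by
  have h : (1 + (j : ℝ)) + (1 + (k : ℝ)) = ((j + k + 1 : ℕ) : ℝ) + 1 := by push_cast; ring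
  rw [betaFn, h, add_comm 1 (j : ℝ), add_comm 1 (k : ℝ), Real.Gamma_nat_eq_factorial,
    Real.Gamma_nat_eq_factorial, Real.Gamma_nat_eq_factorial, Nat.cast_add_choose,
    Nat.factorial_succ]
  push_cast
  field_simp

lemma hasSum_poisson_mul_add_one (a : ℝ) :
    HasSum (fun k : ℕ => Real.exp (-a) * a ^ k / (k ! : ℝ) * (k + 1)) (a + 1) := by
  have h0 : HasSum (fun k : ℕ => a ^ k / (k ! : ℝ)) (Real.exp a) := by
    rw [Real.exp_eq_exp_ℝ]
    exact NormedSpace.expSeries_div_hasSum_exp a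
  have h1 : HasSum (fun k : ℕ => (k : ℝ) * (a ^ k / (k ! : ℝ))) (a * Real.exp a) := by
    rw [← hasSum_nat_add_iff' 1]
    simp only [Finset.sum_range_one, Nat.cast_zero, zero_mul, sub_zero]
    refine (h0.mul_left a).congr_fun fun k => ?_
    rw [Nat.factorial_succ]
    push_cast
    field_simp
    ring
  have h2 := (h1.add h0).mul_left (Real.exp (-a))
  have e : Real.exp (-a) * (a * Real.exp a + Real.exp a) = a + 1 := by
    rw [Real.exp_neg]
    field_simp
  rw [e] at h2
  refine h2.congr_fun fun k => ?_
  ring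

lemma choose_mul_pow_mul_pow_le_one {x : ℝ} (h0 : 0 ≤ x) (h1 : x ≤ 1) (j k : ℕ) :
    ((j + k).choose j : ℝ) * (x ^ j * (1 - x) ^ k) ≤ 1 := by
  have h1' : 0 ≤ 1 - x := sub_nonneg.2 h1
  have hs := add_pow x (1 - x) (j + k)
  rw [add_sub_cancel, one_pow] at hs
  have := Finset.single_le_sum
    (f := fun m => x ^ m * (1 - x) ^ (j + k - m) * ((j + k).choose m : ℝ))
    (s := Finset.range (j + k + 1)) (fun m _ => by positivity)
    (Finset.mem_range.2 (by omega : j < j + k + 1))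
  rw [← hs] at this
  simp only [Nat.add_sub_cancel_left] at this
  linarith

lemma summable_dncBeta_bound (a b : ℝ) (ha : 0 ≤ a) (hb : 0 ≤ b) :
    Summable (fun p : ℕ × ℕ => (Real.exp (-a) * a ^ p.1 / (p.1 ! : ℝ) * (p.1 + 1)) *
      (Real.exp (-b) * b ^ p.2 / (p.2 ! : ℝ) * (p.2 + 1))) :=
  (hasSum_poisson_mul_add_one a).summable.mul_of_nonneg
    (hasSum_poisson_mul_add_one b).summable (fun _ => by dsimp; positivity)
    (fun _ => by dsimp; positivity)

lemma norm_dncBetaTerm_le {a b x : ℝ} (ha : 0 ≤ a) (hb : 0 ≤ b) (hx : x ∈ Set.Icc (0 : ℝ) 1)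
    (p : ℕ × ℕ) :
    ‖dncBetaTerm a b p x‖ ≤ (Real.exp (-a) * a ^ p.1 / (p.1 ! : ℝ) * (p.1 + 1)) *
      (Real.exp (-b) * b ^ p.2 / (p.2 ! : ℝ) * (p.2 + 1)) := by
  obtain ⟨j, k⟩ := p
  have hx1 : 0 ≤ 1 - x := sub_nonneg.2 hx.2
  have hx0 := hx.1
  have hc := choose_mul_pow_mul_pow_le_one hx.1 hx.2 j k
  rw [dncBetaTerm, div_eq_mul_inv (x ^ _ * _), inv_betaFn_one_add,
    Real.norm_of_nonneg (by positivity)]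
  have hw : x ^ j * (1 - x) ^ k * (((j : ℝ) + k + 1) * ((j + k).choose j : ℝ)) ≤
      ((j : ℝ) + 1) * (k + 1) := by
    have hjk : (0 : ℝ) ≤ j * k := by positivity
    have := mul_le_mul_of_nonneg_left hc (by positivity : (0 : ℝ) ≤ (j : ℝ) + k + 1)
    linarith
  have := mul_le_mul_of_nonneg_left hw (by positivity :
    0 ≤ (Real.exp (-a) * a ^ j / (j ! : ℝ)) * (Real.exp (-b) * b ^ k / (k ! : ℝ)))
  exact this.trans_eq (by ring)

lemma continuousOn_tsum_dncBetaTerm {a b : ℝ} (ha : 0 ≤ a) (hb : 0 ≤ b) :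
    ContinuousOn (fun x : ℝ => ∑' j : ℕ, ∑' k : ℕ, dncBetaTerm a b (j, k) x)
      (Set.Icc 0 1) := by
  have hu := summable_dncBeta_bound a b ha hb
  have h : ContinuousOn (fun x : ℝ => ∑' p : ℕ × ℕ, dncBetaTerm a b p x) (Set.Icc 0 1) := by
    refine continuousOn_tsum (fun p => ?_) hu (fun p x hx => norm_dncBetaTerm_le ha hb hx p)
    unfold dncBetaTerm
    fun_prop
  refine h.congr fun x hx => ?_
  exact (Summable.of_norm_bounded hu (norm_dncBetaTerm_le ha hb hx)).tsum_prod.symm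

lemma tsum_dncBetaTerm_zero (a b : ℝ) :
    ∑' j : ℕ, ∑' k : ℕ, dncBetaTerm a b (j, k) 0 = Real.exp (-a) * (b + 1) := by
  rw [tsum_eq_single 0 (fun j hj => by simp [dncBetaTerm, hj])]
  rw [← ((hasSum_poisson_mul_add_one b).mul_left (Real.exp (-a))).tsum_eq]
  refine tsum_congr fun k => ?_
  rw [dncBetaTerm, div_eq_mul_inv (_ ^ _ * _), inv_betaFn_one_add]
  simp
  ring

lemma tsum_dncBetaTerm_one (a b : ℝ) :
    ∑' j : ℕ, ∑' k : ℕ, dncBetaTerm a b (j, k) 1 = Real.exp (-b) * (a + 1) := by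
  rw [← ((hasSum_poisson_mul_add_one a).mul_left (Real.exp (-b))).tsum_eq]
  refine tsum_congr fun j => ?_
  rw [tsum_eq_single 0 (fun k hk => by simp [dncBetaTerm, hk])]
  rw [dncBetaTerm, div_eq_mul_inv (_ ^ _ * _), inv_betaFn_one_add]
  simp
  ring

/-- Limits at `0` and `1` of the doubly non-central beta density with both shape parameters
equal to `1`: the density tends to `e^{−λ1/2}(λ2/2 + 1)` as `x → 0⁺` and to
`e^{−λ2/2}(λ1/2 + 1)` as `x → 1⁻`. -/
theorem dncBeta_density_one_one_limits (lam1 lam2 : ℝ) (hl1 : 0 ≤ lam1) (hl2 : 0 ≤ lam2) :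
    Filter.Tendsto
        (fun x : ℝ => ∑' j : ℕ, ∑' k : ℕ,
          (Real.exp (-(lam1 / 2)) * (lam1 / 2) ^ j / (j ! : ℝ)) *
            (Real.exp (-(lam2 / 2)) * (lam2 / 2) ^ k / (k ! : ℝ)) *
            (x ^ j * (1 - x) ^ k / betaFn (1 + j) (1 + k)))
        (nhdsWithin 0 (Set.Ioi 0)) (nhds (Real.exp (-(lam1 / 2)) * (lam2 / 2 + 1))) ∧
      Filter.Tendsto
        (fun x : ℝ => ∑' j : ℕ, ∑' k : ℕ,
          (Real.exp (-(lam1 / 2)) * (lam1 / 2) ^ j / (j ! : ℝ)) *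
            (Real.exp (-(lam2 / 2)) * (lam2 / 2) ^ k / (k ! : ℝ)) *
            (x ^ j * (1 - x) ^ k / betaFn (1 + j) (1 + k)))
        (nhdsWithin 1 (Set.Iio 1)) (nhds (Real.exp (-(lam2 / 2)) * (lam1 / 2 + 1))) := by
  have hc := continuousOn_tsum_dncBetaTerm (div_nonneg hl1 zero_le_two) (div_nonneg hl2 zero_le_two)
  constructor
  · have h := hc 0 (by simp)
    rw [ContinuousWithinAt, tsum_dncBetaTerm_zero, nhdsWithin_Icc_eq_nhdsGE zero_lt_one] at h
    exact h.mono_left (nhdsWithin_mono _ Set.Ioi_subset_Ici_self)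
  · have h := hc 1 (by simp)
    rw [ContinuousWithinAt, tsum_dncBetaTerm_one, nhdsWithin_Icc_eq_nhdsLE zero_lt_one] at h
    exact h.mono_left (nhdsWithin_mono _ Set.Iio_subset_Iic_self)
end

section
/- Let α1, α2 > 0, λ1, λ2 ≥ 0, set α⁺ = α1 + α2, λ⁺ = λ1 + λ2, and let r ∈ ℕ. Then Σ_{j=0}^{∞} Σ_{k=0}^{∞} (e^{−λ1/2}(λ1/2)^j/j!)·(e^{−λ2/2}(λ2/2)^k/k!) · (α1+j)_r/(α⁺+j+k)_r = [(α1)_r/(α⁺)_r] · e^{−λ⁺/2} · Σ_{i=0}^{r} [binomial(r,i) · (α⁺)_i · (λ1/2)^i / ((α1)_i · (α⁺+r)_i)] · _1F_1(α⁺+i; α⁺+r+i; λ⁺/2). -/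
open scoped Nat

/-- Kummer's confluent hypergeometric function `₁F₁(a;b;z)`. -/
noncomputable def F11 (a b z : ℝ) : ℝ := ∑' k : ℕ, asc a k / asc b k * z ^ k / (k ! : ℝ)

theorem asc_zero (a : ℝ) : asc a 0 = 1 := by simp [asc]

theorem asc_add (a : ℝ) (m n : ℕ) : asc a (m + n) = asc a m * asc (a + m) n := by
  induction m generalizing a with
  | zero => simp [asc_zero]
  | succ m ih =>
    rw [Nat.add_right_comm, asc_succ_left, asc_succ_left, ih, mul_assoc,
      show a + 1 + (m : ℝ) = a + (m + 1 : ℕ) by push_cast; ring]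

theorem asc_mono {a b : ℝ} (ha : 0 < a) (hab : a ≤ b) (n : ℕ) : asc a n ≤ asc b n := by
  induction n generalizing a b with
  | zero => simp [asc_zero]
  | succ n ih =>
    rw [asc_succ_left, asc_succ_left]
    exact mul_le_mul hab (ih (by linarith) (by linarith)) (asc_pos (by linarith) n).le
      (by linarith)

/-- Vandermonde's identity for ascending factorials, with one natural-number argument. -/
theorem asc_add_natCast (a : ℝ) (j r : ℕ) :
    asc (a + j) r =
      ∑ i ∈ Finset.range (r + 1),
        (r.choose i : ℝ) * ((j.descFactorial i : ℝ) * asc (a + i) (r - i)) := by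
  induction r generalizing a with
  | zero => simp [asc_zero]
  | succ r ih =>
    rw [Finset.sum_choose_succ_mul (fun i m => (j.descFactorial i : ℝ) * asc (a + i) m),
      asc_succ_left, show a + j + 1 = a + 1 + j by ring, ih, Finset.mul_sum,
      ← Finset.sum_add_distrib]
    refine Finset.sum_congr rfl fun i hi => ?_
    have hir : i ≤ r := Nat.lt_succ_iff.mp (Finset.mem_range.mp hi)
    have hd : (j.descFactorial (i + 1) : ℝ) = ((j : ℝ) - i) * j.descFactorial i := by
      rcases le_or_gt i j with h | h
      · rw [Nat.descFactorial_succ, Nat.cast_mul, Nat.cast_sub h]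
      · simp [Nat.descFactorial_of_lt h]
    rw [Nat.succ_sub hir, asc_succ_left, hd]
    push_cast
    rw [show a + 1 + (i : ℝ) = a + i + 1 by ring, show a + ((i : ℝ) + 1) = a + i + 1 by ring]
    ring

theorem sum_antidiagonal_pow_div_factorial (x y : ℝ) (n : ℕ) :
    ∑ p ∈ Finset.HasAntidiagonal.antidiagonal n, x ^ p.1 / (p.1 ! : ℝ) * (y ^ p.2 / (p.2 ! : ℝ)) =
      (x + y) ^ n / (n ! : ℝ) := by
  rw [(Commute.all x y).add_pow', Finset.sum_div]
  refine Finset.sum_congr rfl fun p hp => ?_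
  obtain rfl := Finset.HasAntidiagonal.mem_antidiagonal.mp hp
  have h : ((p.1 + p.2).choose p.1 : ℝ) * p.1 ! * p.2 ! = (p.1 + p.2)! := by
    rw [Nat.choose_symm_add]
    exact_mod_cast Nat.add_choose_mul_factorial_mul_factorial p.1 p.2
  have h1 : (p.1 ! : ℝ) ≠ 0 := by positivity
  have h2 : (p.2 ! : ℝ) ≠ 0 := by positivity
  have h3 : ((p.1 + p.2)! : ℝ) ≠ 0 := by positivity
  rw [nsmul_eq_mul]
  field_simp
  linear_combination -(x ^ p.1 * y ^ p.2) * h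

/-- A double exponential series weighted by a bounded function of the total degree collapses to a
single exponential series. -/
theorem hasSum_prod_pow_div_factorial {x y C : ℝ} (hx : 0 ≤ x) (hy : 0 ≤ y) {g : ℕ → ℝ}
    (hg : ∀ n, |g n| ≤ C) :
    HasSum (fun p : ℕ × ℕ => x ^ p.1 / (p.1 ! : ℝ) * (y ^ p.2 / (p.2 ! : ℝ)) * g (p.1 + p.2))
      (∑' n : ℕ, (x + y) ^ n / (n ! : ℝ) * g n) := by
  have hs : Summable fun p : ℕ × ℕ =>
      x ^ p.1 / (p.1 ! : ℝ) * (y ^ p.2 / (p.2 ! : ℝ)) * g (p.1 + p.2) := by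
    refine Summable.of_norm_bounded (((Real.summable_pow_div_factorial x).mul_of_nonneg
      (Real.summable_pow_div_factorial y) (fun _ => by positivity)
      (fun _ => by positivity)).mul_right C) fun p => ?_
    rw [norm_mul, Real.norm_of_nonneg (by positivity)]
    exact mul_le_mul_of_nonneg_left (hg _) (by positivity)
  have hσ := Finset.HasAntidiagonal.sigmaAntidiagonalEquivProd.summable_iff.mpr hs
  convert hs.hasSum using 1
  rw [← Finset.HasAntidiagonal.sigmaAntidiagonalEquivProd.tsum_eq]
  refine Eq.trans (tsum_congr fun n => ?_)
    (hσ.tsum_sigma' fun n => (hasSum_fintype _).summable).symm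
  rw [← sum_antidiagonal_pow_div_factorial, Finset.sum_mul, tsum_fintype,
    ← Finset.sum_coe_sort (Finset.HasAntidiagonal.antidiagonal n)]
  refine Finset.sum_congr rfl fun p _ => ?_
  simp [Finset.HasAntidiagonal.mem_antidiagonal.mp p.2]

theorem hasSum_prod_descFactorial_mul {x y C : ℝ} (hx : 0 ≤ x) (hy : 0 ≤ y) {g : ℕ → ℝ}
    (hg : ∀ n, |g n| ≤ C) (i : ℕ) :
    HasSum (fun p : ℕ × ℕ => x ^ p.1 / (p.1 ! : ℝ) * (y ^ p.2 / (p.2 ! : ℝ)) *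
        ((p.1.descFactorial i : ℝ) * g (p.1 + p.2)))
      (x ^ i * ∑' n : ℕ, (x + y) ^ n / (n ! : ℝ) * g (n + i)) := by
  have hinj : Function.Injective fun p : ℕ × ℕ => (p.1 + i, p.2) := by
    rintro ⟨a, b⟩ ⟨c, d⟩ h
    simpa using h
  rw [← hinj.hasSum_iff]
  · convert! (hasSum_prod_pow_div_factorial hx hy (g := fun n => g (n + i))
      fun n => hg (n + i)).mul_left (x ^ i) using 2 with p
    have h : (p.1 ! : ℝ) * (p.1 + i).descFactorial i = (p.1 + i)! := by
      have := Nat.factorial_mul_descFactorial (Nat.le_add_left i p.1)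
      rw [Nat.add_sub_cancel] at this
      exact_mod_cast this
    have h1 : (p.1 ! : ℝ) ≠ 0 := by positivity
    have h3 : ((p.1 + i)! : ℝ) ≠ 0 := by positivity
    simp only [Function.comp_apply]
    rw [show p.1 + i + p.2 = p.1 + p.2 + i by ring, pow_add]
    have h4 : ((p.1 + i).descFactorial i : ℝ) / (p.1 + i)! = 1 / p.1 ! := by
      rw [div_eq_div_iff h3 h1]
      linear_combination h
    linear_combination (x ^ p.1 * x ^ i * (y ^ p.2 / (p.2 ! : ℝ)) * g (p.1 + p.2 + i)) * h4
  · rintro ⟨j, k⟩ h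
    have hj : j < i := by
      by_contra! hij
      exact h ⟨(j - i, k), by simp [hij]⟩
    simp [Nat.descFactorial_of_lt hj]

theorem asc_mul_asc_comm (s : ℝ) (m r : ℕ) :
    asc s m * asc (s + m) r = asc s r * asc (s + r) m := by
  rw [← asc_add, ← asc_add, add_comm]

theorem one_div_asc_add {s : ℝ} (hs : 0 < s) (n i r : ℕ) :
    1 / asc (s + (n + i : ℕ)) r =
      asc s i / (asc s r * asc (s + r) i) * (asc (s + i) n / asc (s + r + i) n) := by
  have h := asc_mul_asc_comm s (i + n) r
  rw [asc_add s i n, asc_add (s + r) i n, add_comm i n] at h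
  have h1 := (asc_pos (show 0 < s + (n + i : ℕ) by positivity) r).ne'
  have h2 := (asc_pos hs r).ne'
  have h3 := (asc_pos (show 0 < s + r by positivity) i).ne'
  have h4 := (asc_pos (show 0 < s + r + i by positivity) n).ne'
  field_simp
  linear_combination -h

/-- Moments about zero of the doubly non-central beta distribution:
the `r`-th moment (the Poisson-weighted mixture of beta moments) equals
`[(α1)_r/(α⁺)_r] e^{−λ⁺/2} Σ_{i=0}^{r} [C(r,i)(α⁺)_i(λ1/2)^i/((α1)_i(α⁺+r)_i)]
·₁F₁(α⁺+i; α⁺+r+i; λ⁺/2)`. -/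
theorem dncBeta_moment (α1 α2 lam1 lam2 : ℝ)
    (hα1 : 0 < α1) (hα2 : 0 < α2) (hl1 : 0 ≤ lam1) (hl2 : 0 ≤ lam2) (r : ℕ) :
    (∑' j : ℕ, ∑' k : ℕ,
        (Real.exp (-(lam1 / 2)) * (lam1 / 2) ^ j / (j ! : ℝ)) *
          (Real.exp (-(lam2 / 2)) * (lam2 / 2) ^ k / (k ! : ℝ)) *
          (asc (α1 + j) r / asc (α1 + α2 + j + k) r)) =
      (asc α1 r / asc (α1 + α2) r) * Real.exp (-((lam1 + lam2) / 2)) *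
        ∑ i ∈ Finset.range (r + 1),
          ((r.choose i : ℝ) * asc (α1 + α2) i * (lam1 / 2) ^ i /
              (asc α1 i * asc (α1 + α2 + r) i)) *
            F11 (α1 + α2 + i) (α1 + α2 + r + i) ((lam1 + lam2) / 2) := by
  set x := lam1 / 2 with hx
  set y := lam2 / 2 with hy
  have hx0 : 0 ≤ x := by positivity
  have hy0 : 0 ≤ y := by positivity
  have hs : 0 < α1 + α2 := by positivity
  have hxy : (lam1 + lam2) / 2 = x + y := by rw [hx, hy]; ring
  have hg (n : ℕ) : |1 / asc (α1 + α2 + n) r| ≤ 1 / asc (α1 + α2) r := by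
    rw [abs_of_pos (one_div_pos.mpr (asc_pos (by positivity) r))]
    exact one_div_le_one_div_of_le (asc_pos hs r) (asc_mono hs (by simp) r)
  have hsum := (hasSum_sum (s := Finset.range (r + 1)) fun i _ =>
    (hasSum_prod_descFactorial_mul hx0 hy0 hg i).mul_left
      ((r.choose i : ℝ) * asc (α1 + i) (r - i))).mul_left (Real.exp (-(x + y)))
  have hterm : (fun p : ℕ × ℕ => (Real.exp (-x) * x ^ p.1 / (p.1 ! : ℝ)) *
      (Real.exp (-y) * y ^ p.2 / (p.2 ! : ℝ)) *
      (asc (α1 + p.1) r / asc (α1 + α2 + p.1 + p.2) r)) = fun p : ℕ × ℕ =>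
      Real.exp (-(x + y)) * ∑ i ∈ Finset.range (r + 1),
        (r.choose i : ℝ) * asc (α1 + i) (r - i) *
          (x ^ p.1 / (p.1 ! : ℝ) * (y ^ p.2 / (p.2 ! : ℝ)) *
            ((p.1.descFactorial i : ℝ) * (1 / asc (α1 + α2 + (p.1 + p.2 : ℕ)) r))) := by
    funext p
    rw [asc_add_natCast, neg_add, Real.exp_add, Finset.sum_div, Finset.mul_sum, Finset.mul_sum]
    refine Finset.sum_congr rfl fun i _ => ?_
    rw [Nat.cast_add, ← add_assoc]
    ring
  rw [← hterm] at hsum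
  rw [← hsum.summable.tsum_prod, hsum.tsum_eq, hxy, mul_comm (asc α1 r / _), mul_assoc,
    Finset.mul_sum (a := asc α1 r / _)]
  congr 1
  refine Finset.sum_congr rfl fun i hi => ?_
  have hir : i ≤ r := Nat.lt_succ_iff.mp (Finset.mem_range.mp hi)
  have hsplit : asc α1 r = asc α1 i * asc (α1 + i) (r - i) := by
    rw [← asc_add, Nat.add_sub_cancel' hir]
  have hF : ∑' n : ℕ, (x + y) ^ n / (n ! : ℝ) * (1 / asc (α1 + α2 + (n + i : ℕ)) r) =
      asc (α1 + α2) i / (asc (α1 + α2) r * asc (α1 + α2 + r) i) *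
        F11 (α1 + α2 + i) (α1 + α2 + r + i) (x + y) := by
    rw [F11, ← tsum_mul_left]
    refine tsum_congr fun n => ?_
    rw [one_div_asc_add hs]
    ring
  have h1 := (asc_pos hα1 i).ne'
  rw [hF, hsplit]
  field_simp
end

section
/- Let α1, α2 > 0 and λ1, λ2 ≥ 0 with λ⁺ = λ1 + λ2 > 0, and set α⁺ = α1 + α2. Then M = (λ1/λ⁺)·M₁ + (λ2/λ⁺)·M₂, where M = Σ_{j=0}^{∞} Σ_{k=0}^{∞} (e^{−λ1/2}(λ1/2)^j/j!)·(e^{−λ2/2}(λ2/2)^k/k!)·(α1+j)/(α⁺+j+k) is the mean of the doubly non-central beta distribution with parameters (α1, α2, λ1, λ2), M₁ = Σ_{j=0}^{∞} (e^{−λ⁺/2}(λ⁺/2)^j/j!)·(α1+j)/(α⁺+j) is the mean of the type 1 non-central beta distribution with parameters (α1, α2, λ⁺), and M₂ = Σ_{k=0}^{∞} (e^{−λ⁺/2}(λ⁺/2)^k/k!)·α1/(α⁺+k) is the mean of the type 2 non-central beta distribution with parameters (α1, α2, λ⁺). -/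
open scoped Nat

/-- First moment version of `sum_antidiagonal_pow_div_factorial`. -/
theorem add_mul_sum_antidiagonal_pow_div_factorial_mul (x y : ℝ) (n : ℕ) :
    (x + y) * ∑ p ∈ Finset.HasAntidiagonal.antidiagonal n,
        x ^ p.1 / (p.1 ! : ℝ) * (y ^ p.2 / (p.2 ! : ℝ)) * p.1 =
      n * x * ((x + y) ^ n / (n ! : ℝ)) := by
  cases n with
  | zero => simp
  | succ m =>
    have h : ∀ p : ℕ × ℕ, x ^ (p.1 + 1) / ((p.1 + 1)! : ℝ) * (y ^ p.2 / (p.2 ! : ℝ)) *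
        ((p.1 + 1 : ℕ) : ℝ) = x * (x ^ p.1 / (p.1 ! : ℝ) * (y ^ p.2 / (p.2 ! : ℝ))) := by
      intro p
      rw [Nat.factorial_succ]
      push_cast
      field_simp
      ring
    rw [Finset.Nat.sum_antidiagonal_succ]
    simp only [h, ← Finset.mul_sum, sum_antidiagonal_pow_div_factorial]
    rw [Nat.factorial_succ]
    push_cast
    field_simp
    ring

/-- Averaging a `[0, 1]`-valued sequence against Poisson weights gives a summable series. -/
theorem summable_poisson_weight_mul (x : ℝ) (hx : 0 ≤ x) {f : ℕ → ℝ} (hf0 : ∀ n, 0 ≤ f n)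
    (hf1 : ∀ n, f n ≤ 1) :
    Summable fun n : ℕ => Real.exp (-x) * x ^ n / (n ! : ℝ) * f n := by
  refine ((Real.summable_pow_div_factorial x).mul_left (Real.exp (-x))).of_nonneg_of_le
    (fun n => mul_nonneg (by positivity) (hf0 n)) fun n => ?_
  rw [mul_div_assoc]
  exact mul_le_of_le_one_right (by positivity) (hf1 n)

/-- Relationship among the means of the doubly non-central beta distribution (with parameters
`(α1, α2, λ1, λ2)`) and the type 1 and type 2 non-central beta distributions (with parameters
`(α1, α2, λ⁺)`, `λ⁺ = λ1 + λ2`): `M = (λ1/λ⁺)·M₁ + (λ2/λ⁺)·M₂`. -/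
theorem dncBeta_mean_convex_combination (α1 α2 lam1 lam2 : ℝ)
    (hα1 : 0 < α1) (hα2 : 0 < α2) (hl1 : 0 ≤ lam1) (hl2 : 0 ≤ lam2)
    (hlsum : 0 < lam1 + lam2) :
    (∑' j : ℕ, ∑' k : ℕ,
        (Real.exp (-(lam1 / 2)) * (lam1 / 2) ^ j / (j ! : ℝ)) *
          (Real.exp (-(lam2 / 2)) * (lam2 / 2) ^ k / (k ! : ℝ)) *
          ((α1 + j) / (α1 + α2 + j + k))) =
      (lam1 / (lam1 + lam2)) *
          (∑' j : ℕ, (Real.exp (-((lam1 + lam2) / 2)) * ((lam1 + lam2) / 2) ^ j / (j ! : ℝ)) *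
            ((α1 + j) / (α1 + α2 + j))) +
        (lam2 / (lam1 + lam2)) *
          (∑' k : ℕ, (Real.exp (-((lam1 + lam2) / 2)) * ((lam1 + lam2) / 2) ^ k / (k ! : ℝ)) *
            (α1 / (α1 + α2 + k))) := by
  have hx : 0 ≤ lam1 / 2 := by positivity
  have hy : 0 ≤ lam2 / 2 := by positivity
  have hxy : (lam1 + lam2) / 2 = lam1 / 2 + lam2 / 2 := by ring
  have hw1 : lam1 / (lam1 + lam2) = lam1 / 2 / (lam1 / 2 + lam2 / 2) := by
    field_simp
  have hw2 : lam2 / (lam1 + lam2) = lam2 / 2 / (lam1 / 2 + lam2 / 2) := by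
    field_simp
  have hs : 0 < lam1 / 2 + lam2 / 2 := by linarith
  rw [hw1, hw2, hxy]
  generalize lam1 / 2 = x at *
  generalize lam2 / 2 = y at *
  set F : ℕ × ℕ → ℝ := fun p =>
    (Real.exp (-x) * x ^ p.1 / (p.1 ! : ℝ)) * (Real.exp (-y) * y ^ p.2 / (p.2 ! : ℝ)) *
      ((α1 + p.1) / (α1 + α2 + p.1 + p.2)) with hF
  have hFs : Summable F := by
    have hone (z : ℝ) (hz : 0 ≤ z) : Summable fun n : ℕ => Real.exp (-z) * z ^ n / (n ! : ℝ) := by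
      simpa using summable_poisson_weight_mul z hz (f := fun _ => 1) (by simp) (by simp)
    refine ((hone x hx).mul_of_nonneg (hone y hy) (fun n => by positivity)
      (fun n => by positivity)).of_nonneg_of_le (fun p => by positivity) fun p => ?_
    refine mul_le_of_le_one_right (by positivity) (div_le_one_of_le₀ ?_ (by positivity))
    have : (0 : ℝ) ≤ p.2 := by positivity
    linarith
  have hdiag (n : ℕ) : ∑ p ∈ Finset.HasAntidiagonal.antidiagonal n, F p =
      x / (x + y) * (Real.exp (-(x + y)) * (x + y) ^ n / (n ! : ℝ) *
        ((α1 + n) / (α1 + α2 + n))) +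
      y / (x + y) * (Real.exp (-(x + y)) * (x + y) ^ n / (n ! : ℝ) *
        (α1 / (α1 + α2 + n))) := by
    have hd : α1 + α2 + n ≠ 0 := by positivity
    have h0 := sum_antidiagonal_pow_div_factorial x y n
    have h1 := add_mul_sum_antidiagonal_pow_div_factorial_mul x y n
    have hsum : ∑ p ∈ Finset.HasAntidiagonal.antidiagonal n, F p =
        Real.exp (-(x + y)) / (α1 + α2 + n) *
          (α1 * (∑ p ∈ Finset.HasAntidiagonal.antidiagonal n,
              x ^ p.1 / (p.1 ! : ℝ) * (y ^ p.2 / (p.2 ! : ℝ))) +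
            ∑ p ∈ Finset.HasAntidiagonal.antidiagonal n,
              x ^ p.1 / (p.1 ! : ℝ) * (y ^ p.2 / (p.2 ! : ℝ)) * p.1) := by
      rw [Finset.mul_sum, ← Finset.sum_add_distrib, Finset.mul_sum]
      refine Finset.sum_congr rfl fun p hp => ?_
      have hn : (n : ℝ) = p.1 + p.2 := by
        exact_mod_cast (Finset.HasAntidiagonal.mem_antidiagonal.mp hp).symm
      rw [hF, neg_add, Real.exp_add, hn, ← add_assoc (α1 + α2)]
      ring
    rw [eq_div_of_mul_eq hs.ne' ((mul_comm _ _).trans h1), h0] at hsum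
    rw [hsum]
    field_simp
    ring
  have hS1 := summable_poisson_weight_mul (x + y) hs.le
    (f := fun n => (α1 + n) / (α1 + α2 + n)) (fun n => by positivity)
    (fun n => div_le_one_of_le₀ (by linarith) (by positivity))
  have hS2 := summable_poisson_weight_mul (x + y) hs.le
    (f := fun n => α1 / (α1 + α2 + n)) (fun n => by positivity)
    (fun n => div_le_one_of_le₀ (by linarith [n.cast_nonneg (α := ℝ)]) (by positivity))
  calc _ = ∑' p, F p := hFs.tsum_prod.symm
    _ = ∑' n, ∑ p ∈ Finset.HasAntidiagonal.antidiagonal n, F p := by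
      have hFσ := Finset.HasAntidiagonal.sigmaAntidiagonalEquivProd.summable_iff.mpr hFs
      rw [← Finset.HasAntidiagonal.sigmaAntidiagonalEquivProd.tsum_eq F]
      refine hFσ.tsum_sigma.trans (tsum_congr fun n => ?_)
      rw [tsum_fintype]
      exact Finset.sum_coe_sort (Finset.HasAntidiagonal.antidiagonal n) F
    _ = _ := by
      simp only [hdiag]
      rw [(hS1.mul_left _).tsum_add (hS2.mul_left _), tsum_mul_left, tsum_mul_left]
end
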